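/- Exactness at the finest partition (core of the proof of Proposition 3): Suppose that for every block i and every nonempty bucket B ∈ 𝓑 i, all subpaths σ : S i with t i σ ∈ B have the same contribution vector t i σ. If a feasible path exists, then a pessimistically feasible selection exists and cPes 𝓑 equals the minimum of ∑ i, c i (p i) over all feasible paths p. -/

import Mathlib

/-- Exactness at the finest partition (core of the proof of Proposition 3): if within
every bucket all subpaths share the same contribution vector, and a feasible path exists,
then a pessimistically feasible selection exists and `cPes 𝓑` equals the minimum cost over
all feasible paths. -/
theorem stmt_7
    (n d : ℕ) (hn : 1 ≤ n)
    (S : Fin n → Type) [∀ i, Fintype (S i)] [∀ i, Nonempty (S i)]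
    (c : ∀ i, S i → ℝ) (t : ∀ i, S i → Fin d → ℤ)
    (Feas : (Fin n → Fin d → ℤ) → Prop)
    (hFeas : IsLowerSet {v : Fin n → Fin d → ℤ | Feas v})
    (𝓑 : Fin n → Finset ((Fin d → ℤ) × (Fin d → ℤ)))
    (hdisj : ∀ i, ∀ B ∈ 𝓑 i, ∀ B' ∈ 𝓑 i, B ≠ B' →
      Disjoint (Set.Icc B.1 B.2) (Set.Icc B'.1 B'.2))
    (hcover : ∀ i (σ : S i), ∃ B ∈ 𝓑 i, t i σ ∈ Set.Icc B.1 B.2)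
    (rep : ∀ i, (Fin d → ℤ) × (Fin d → ℤ) → S i)
    (hrep_mem : ∀ (i : Fin n) (B : (Fin d → ℤ) × (Fin d → ℤ)),
      (∃ σ : S i, t i σ ∈ Set.Icc B.1 B.2) → t i (rep i B) ∈ Set.Icc B.1 B.2)
    (hrep_min : ∀ (i : Fin n) (B : (Fin d → ℤ) × (Fin d → ℤ)),
      (∃ σ : S i, t i σ ∈ Set.Icc B.1 B.2) →
      ∀ σ : S i, t i σ ∈ Set.Icc B.1 B.2 → c i (rep i B) ≤ c i σ)
    -- all subpaths within a bucket share the same contribution vector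
    (hsame : ∀ i, ∀ B ∈ 𝓑 i, ∀ σ σ' : S i,
      t i σ ∈ Set.Icc B.1 B.2 → t i σ' ∈ Set.Icc B.1 B.2 → t i σ = t i σ')
    -- a feasible path exists
    (p : ∀ i, S i) (hp : Feas (fun i => t i (p i))) :
    (∃ b : Fin n → (Fin d → ℤ) × (Fin d → ℤ),
      (∀ i, b i ∈ 𝓑 i) ∧ (∀ i, ∃ σ : S i, t i σ ∈ Set.Icc (b i).1 (b i).2) ∧
      Feas (fun i => t i (rep i (b i)))) ∧
    sInf {x : ℝ | ∃ b : Fin n → (Fin d → ℤ) × (Fin d → ℤ),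
        (∀ i, b i ∈ 𝓑 i) ∧ (∀ i, ∃ σ : S i, t i σ ∈ Set.Icc (b i).1 (b i).2) ∧
        Feas (fun i => t i (rep i (b i))) ∧ x = ∑ i, c i (rep i (b i))} =
      sInf {x : ℝ | ∃ q : ∀ i, S i, Feas (fun i => t i (q i)) ∧ x = ∑ i, c i (q i)} := by
  have key : ∀ q : ∀ i, S i, Feas (fun i => t i (q i)) →
      ∃ b : Fin n → (Fin d → ℤ) × (Fin d → ℤ),
        (∀ i, b i ∈ 𝓑 i) ∧ (∀ i, ∃ σ : S i, t i σ ∈ Set.Icc (b i).1 (b i).2) ∧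
        Feas (fun i => t i (rep i (b i))) ∧ ∑ i, c i (rep i (b i)) ≤ ∑ i, c i (q i) := by
    intro q hq
    choose b hb hqb using fun i => hcover i (q i)
    have ht : (fun i => t i (rep i (b i))) = fun i => t i (q i) := funext fun i =>
      hsame i (b i) (hb i) _ _ (hrep_mem i (b i) ⟨q i, hqb i⟩) (hqb i)
    exact ⟨b, hb, fun i => ⟨q i, hqb i⟩, ht ▸ hq,
      Finset.sum_le_sum fun i _ => hrep_min i (b i) ⟨q i, hqb i⟩ (q i) (hqb i)⟩
  have hbdd : BddBelow
      {x : ℝ | ∃ q : ∀ i, S i, Feas (fun i => t i (q i)) ∧ x = ∑ i, c i (q i)} := by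
    refine ((Set.finite_range fun q : ∀ i, S i => ∑ i, c i (q i)).subset ?_).bddBelow
    rintro x ⟨q, -, rfl⟩
    exact ⟨q, rfl⟩
  obtain ⟨b, hb, hne, hbF, -⟩ := key p hp
  refine ⟨⟨b, hb, hne, hbF⟩, le_antisymm ?_ ?_⟩
  · refine le_csInf ⟨_, p, hp, rfl⟩ ?_
    rintro x ⟨q, hq, rfl⟩
    obtain ⟨b', hb', hne', hbF', hle⟩ := key q hq
    refine csInf_le_of_le (hbdd.mono ?_) ⟨b', hb', hne', hbF', rfl⟩ hle
    rintro x ⟨b'', -, -, hF, rfl⟩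
    exact ⟨_, hF, rfl⟩
  · refine le_csInf ⟨_, b, hb, hne, hbF, rfl⟩ ?_
    rintro x ⟨b', -, -, hF, rfl⟩
    exact csInf_le hbdd ⟨_, hF, rfl⟩
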